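/- Let n ≥ 1, 0 < ε ≤ 1, 0 ≤ ρ ≤ 1 and 1 ≤ p ≤ ∞. Let ω : [0,∞) → [0,∞) be non-decreasing and bounded with ∫₀¹ ω(t) t⁻¹ dt < ∞. Let σ₁ : ℝⁿ → ℂ be a smooth symbol for which there is C > 0 such that |∂_ξ^α σ₁(ξ)| ≤ C ω(⟨ξ⟩^{−ε}) ⟨ξ⟩^{−(n/2)(1−ρ) − ρ|α|} for all ξ ∈ ℝⁿ and all multi-indices α with |α| ≤ [n/2]+1. Then the periodic Fourier multiplier σ(D) with symbol σ(ξ) = σ₁(ξ) for ξ ∈ ℤⁿ is a bounded operator on L^p(𝕋ⁿ). -/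

import Mathlib

open MeasureTheory Real ENNReal

noncomputable section

/-- Partial derivative of a complex-valued function on `ℝⁿ` in the `j`-th coordinate
direction. -/
def pd {n : ℕ} (j : Fin n) (f : (Fin n → ℝ) → ℂ) : (Fin n → ℝ) → ℂ :=
  fun x => fderiv ℝ f x (Pi.single j 1)

/-- The canonical list of directions associated to a multi-index `β ∈ ℕⁿ`. -/
def mIdxList {n : ℕ} (β : Fin n → ℕ) : List (Fin n) :=
  (List.finRange n).flatMap fun j => List.replicate (β j) j

/-- Iterated partial derivative `∂^β` associated to a multi-index `β`. -/
def pdM {n : ℕ} (β : Fin n → ℕ) (f : (Fin n → ℝ) → ℂ) : (Fin n → ℝ) → ℂ :=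
  (mIdxList β).foldr pd f

/-- Forward difference operator in the `j`-th direction on functions of `ξ ∈ ℤⁿ`. -/
def dd {n : ℕ} (j : Fin n) (g : (Fin n → ℤ) → ℂ) : (Fin n → ℤ) → ℂ :=
  fun ξ => g (ξ + Pi.single j 1) - g ξ

/-- Iterated difference operator `Δ_ξ^α` associated to a multi-index `α`. -/
def ddM {n : ℕ} (α : Fin n → ℕ) (g : (Fin n → ℤ) → ℂ) : (Fin n → ℤ) → ℂ :=
  (mIdxList α).foldr dd g

/-- Japanese bracket `⟨ξ⟩ = (1+|ξ|²)^{1/2}` of a lattice point `ξ ∈ ℤⁿ`. -/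
def jb {n : ℕ} (ξ : Fin n → ℤ) : ℝ := Real.sqrt (1 + ∑ j, ((ξ j : ℝ)) ^ 2)

/-- Japanese bracket `⟨ξ⟩ = (1+|ξ|²)^{1/2}` of a vector `ξ ∈ ℝⁿ`. -/
def jbR {n : ℕ} (ξ : Fin n → ℝ) : ℝ := Real.sqrt (1 + ∑ j, (ξ j) ^ 2)

/-- The canonical embedding `ℤⁿ → ℝⁿ`. -/
def castZ {n : ℕ} (ξ : Fin n → ℤ) : Fin n → ℝ := fun j => (ξ j : ℝ)

/-- The fundamental domain `[0,1)ⁿ` of the torus `𝕋ⁿ = ℝⁿ/ℤⁿ`. -/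
def cube (n : ℕ) : Set (Fin n → ℝ) := Set.univ.pi fun _ => Set.Ico (0 : ℝ) 1

/-- The normalized Lebesgue measure of the torus `𝕋ⁿ`, realized as the Lebesgue measure
on `ℝⁿ` restricted to the fundamental domain `[0,1)ⁿ`. -/
def μT (n : ℕ) : Measure (Fin n → ℝ) := volume.restrict (cube n)

/-- `1`-periodicity of a function on `ℝⁿ` (i.e. the function descends to `𝕋ⁿ`). -/
def Per {n : ℕ} (f : (Fin n → ℝ) → ℂ) : Prop :=
  ∀ (x : Fin n → ℝ) (v : Fin n → ℤ), f (x + fun j => (v j : ℝ)) = f x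

/-- The character `e^{2πi⟨x,ξ⟩}`. -/
def eChar {n : ℕ} (x : Fin n → ℝ) (ξ : Fin n → ℤ) : ℂ :=
  Complex.exp (2 * (π : ℂ) * Complex.I * ∑ j, (x j : ℂ) * (ξ j : ℂ))

/-- Fourier coefficient `f̂(ξ) = ∫_{𝕋ⁿ} e^{-2πi⟨x,ξ⟩} f(x) dx` of a function on `𝕋ⁿ`. -/
def fc {n : ℕ} (f : (Fin n → ℝ) → ℂ) (ξ : Fin n → ℤ) : ℂ :=
  ∫ x, Complex.exp (-(2 * (π : ℂ) * Complex.I) * ∑ j, (x j : ℂ) * (ξ j : ℂ)) * f x ∂(μT n)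

/-- Periodic pseudo-differential operator
    `σ(x,D)f(x) = Σ_{ξ ∈ ℤⁿ} e^{2πi⟨x,ξ⟩} σ(x,ξ) f̂(ξ)`
with symbol `σ` on `𝕋ⁿ × ℤⁿ`. -/
def Op {n : ℕ} (σ : (Fin n → ℝ) → (Fin n → ℤ) → ℂ) (f : (Fin n → ℝ) → ℂ) :
    (Fin n → ℝ) → ℂ :=
  fun x => ∑' ξ : Fin n → ℤ, eChar x ξ * σ x ξ * fc f ξ

/-- The `L^p(𝕋ⁿ)` norm, for a real exponent `p`. -/
def lpT (n : ℕ) (p : ℝ) (g : (Fin n → ℝ) → ℂ) : ℝ :=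
  (∫ x, ‖g x‖ ^ p ∂(μT n)) ^ (1 / p)

/-- `∂_x^β Δ_ξ^α σ(x,ξ)` for a symbol `σ` on `𝕋ⁿ × ℤⁿ` (difference operator applied first,
then the derivatives in `x`). -/
def symbDxD {n : ℕ} (β α : Fin n → ℕ) (σ : (Fin n → ℝ) → (Fin n → ℤ) → ℂ)
    (x : Fin n → ℝ) (ξ : Fin n → ℤ) : ℂ :=
  pdM β (fun x' => ddM α (σ x') ξ) x

/-- `Δ_ξ^α ∂_x^β σ(x,ξ)` for a symbol `σ` on `𝕋ⁿ × ℤⁿ` (derivatives in `x` applied first,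
then the difference operator in `ξ`). -/
def symbDDx {n : ℕ} (α β : Fin n → ℕ) (σ : (Fin n → ℝ) → (Fin n → ℤ) → ℂ)
    (x : Fin n → ℝ) (ξ : Fin n → ℤ) : ℂ :=
  ddM α (fun ξ' => pdM β (fun x' => σ x' ξ') x) ξ

/-- `∂_ξ^α ∂_x^β σ(x,ξ)` for a symbol `σ` on `𝕋ⁿ × ℝⁿ` (derivatives in `x` applied first,
then the derivatives in `ξ`). -/
def symbDξDx {n : ℕ} (α β : Fin n → ℕ) (σ : (Fin n → ℝ) → (Fin n → ℝ) → ℂ)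
    (x ξ : Fin n → ℝ) : ℂ :=
  pdM α (fun ξ' => pdM β (fun x' => σ x' ξ') x) ξ

/-- `∂_x^β ∂_ξ^α σ(x,ξ)` for a symbol `σ` on `𝕋ⁿ × ℝⁿ` (derivatives in `ξ` applied first,
then the derivatives in `x`). -/
def symbDxDξ {n : ℕ} (β α : Fin n → ℕ) (σ : (Fin n → ℝ) → (Fin n → ℝ) → ℂ)
    (x ξ : Fin n → ℝ) : ℂ :=
  pdM β (fun x' => pdM α (σ x') ξ) x

/-- The Euclidean Fourier transform `û(ξ) = ∫_{ℝⁿ} e^{-2πi⟨x,ξ⟩} u(x) dx`. -/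
def FT {n : ℕ} (u : (Fin n → ℝ) → ℂ) (ξ : Fin n → ℝ) : ℂ :=
  ∫ x, Complex.exp (-(2 * (π : ℂ) * Complex.I) * ∑ j, (x j : ℂ) * (ξ j : ℂ)) * u x

/-- Pseudo-differential operator on `ℝⁿ`:
`T_σ u(x) = ∫_{ℝⁿ} e^{2πi⟨x,ξ⟩} σ(x,ξ) û(ξ) dξ`. -/
def OpR {n : ℕ} (σ : (Fin n → ℝ) → (Fin n → ℝ) → ℂ) (u : (Fin n → ℝ) → ℂ) :
    (Fin n → ℝ) → ℂ :=
  fun x => ∫ ξ, Complex.exp (2 * (π : ℂ) * Complex.I * ∑ j, (x j : ℂ) * (ξ j : ℂ)) * σ x ξ * FT u ξ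

/-- Periodic amplitude operator
`a(x,y,D)u(x) = ∫_{𝕋ⁿ} ∫_{ℝⁿ} e^{2πi⟨x-y,ξ⟩} a(x,y,ξ) u(y) dξ dy`. -/
def OpAmp {n : ℕ} (a : (Fin n → ℝ) → (Fin n → ℝ) → (Fin n → ℝ) → ℂ)
    (u : (Fin n → ℝ) → ℂ) : (Fin n → ℝ) → ℂ :=
  fun x => ∫ y,
    (∫ ξ, Complex.exp (2 * (π : ℂ) * Complex.I * ∑ j, ((x j : ℂ) - (y j : ℂ)) * (ξ j : ℂ)) *
        a x y ξ) * u y ∂(μT n)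

/-- The `L^p(ℝⁿ)` norm, for a real exponent `p`. -/
def lpR (n : ℕ) (p : ℝ) (g : (Fin n → ℝ) → ℂ) : ℝ :=
  (∫ x, ‖g x‖ ^ p) ^ (1 / p)



/-- The trigonometric series on the torus with coefficients `c`. -/
def trigSeries {n : ℕ} (c : (Fin n → ℤ) → ℂ) (t : UnitAddTorus (Fin n)) : ℂ :=
  ∑' ξ, c ξ * UnitAddTorus.mFourier ξ t

lemma trigSeries_eq_sum {n : ℕ} {c : (Fin n → ℤ) → ℂ} {S : Finset (Fin n → ℤ)}
    (hS : ∀ ξ ∉ S, c ξ = 0) (t : UnitAddTorus (Fin n)) :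
    trigSeries c t = ∑ ξ ∈ S, c ξ * UnitAddTorus.mFourier ξ t :=
  tsum_eq_sum fun ξ hξ => by simp [hS ξ hξ]

lemma continuous_trigSeries {n : ℕ} {c : (Fin n → ℤ) → ℂ} (hc : c.support.Finite) :
    Continuous (trigSeries c) := by
  have h : trigSeries c = fun t => ∑ ξ ∈ hc.toFinset, c ξ * UnitAddTorus.mFourier ξ t := by
    funext t
    exact trigSeries_eq_sum (by simp) t
  rw [h]
  fun_prop

lemma norm_mFourier_apply {n : ℕ} (ξ : Fin n → ℤ) (t : UnitAddTorus (Fin n)) :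
    ‖UnitAddTorus.mFourier ξ t‖ = 1 := by
  simp [UnitAddTorus.mFourier, fourier_apply, -zsmul_eq_mul, norm_prod,
    Circle.norm_coe]

lemma summable_trigSeries {n : ℕ} {c : (Fin n → ℤ) → ℂ} (hc : c.support.Finite)
    (t : UnitAddTorus (Fin n)) : Summable fun ξ => c ξ * UnitAddTorus.mFourier ξ t :=
  summable_of_hasFiniteSupport (hc.subset fun ξ h => by
    simp only [Function.mem_support] at h ⊢
    exact left_ne_zero_of_mul h)

lemma finite_support_comp_add {n : ℕ} {c : (Fin n → ℤ) → ℂ} (hc : c.support.Finite)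
    (v : Fin n → ℤ) : (fun ξ => c (ξ + v)).support.Finite :=
  (hc.preimage (f := fun ξ => ξ + v) (add_left_injective v).injOn)

lemma finite_support_dd {n : ℕ} {c : (Fin n → ℤ) → ℂ} (hc : c.support.Finite) (j : Fin n) :
    (dd j c).support.Finite :=
  ((finite_support_comp_add hc (Pi.single j 1)).union hc).subset
    (Function.support_sub _ _)

lemma trigSeries_dd {n : ℕ} {c : (Fin n → ℤ) → ℂ} (hc : c.support.Finite) (j : Fin n)
    (t : UnitAddTorus (Fin n)) :
    trigSeries (dd j c) t = (fourier (-1) (t j) - 1) * trigSeries c t := by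
  have h1 : ∑' ξ, c (ξ + Pi.single j 1) * UnitAddTorus.mFourier ξ t
      = fourier (-1) (t j) * trigSeries c t := by
    rw [trigSeries, ← tsum_mul_left, ← (Equiv.addRight (Pi.single j (1 : ℤ))).tsum_eq
      fun ξ => (fourier (-1) (t j) : ℂ) * (c ξ * UnitAddTorus.mFourier ξ t)]
    refine tsum_congr fun ξ => ?_
    have h2 : (fourier (-1) (t j) : ℂ) * fourier 1 (t j) = 1 := by
      rw [← fourier_add]; simp
    simp only [Equiv.coe_addRight, UnitAddTorus.mFourier_add, UnitAddTorus.mFourier_single]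
    linear_combination (-c (ξ + Pi.single j 1) * UnitAddTorus.mFourier ξ t) * h2
  calc trigSeries (dd j c) t
      = ∑' ξ, (c (ξ + Pi.single j 1) * UnitAddTorus.mFourier ξ t
          - c ξ * UnitAddTorus.mFourier ξ t) := by simp only [trigSeries, dd, sub_mul]
    _ = _ := by
      rw [(summable_trigSeries (finite_support_comp_add hc _) t).tsum_sub
        (summable_trigSeries hc t), h1]
      simp only [trigSeries]; ring

lemma finite_support_iterate_dd {n : ℕ} {c : (Fin n → ℤ) → ℂ} (hc : c.support.Finite)
    (j : Fin n) (N : ℕ) : ((dd j)^[N] c).support.Finite := by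
  induction N with
  | zero => exact hc
  | succ N ih => rw [Function.iterate_succ_apply']; exact finite_support_dd ih j

lemma norm_trigSeries_iterate_dd {n : ℕ} {c : (Fin n → ℤ) → ℂ} (hc : c.support.Finite)
    (j : Fin n) (N : ℕ) (t : UnitAddTorus (Fin n)) :
    ‖trigSeries ((dd j)^[N] c) t‖ = ‖(fourier (-1) (t j) : ℂ) - 1‖ ^ N * ‖trigSeries c t‖ := by
  induction N with
  | zero => simp
  | succ N ih =>
    rw [Function.iterate_succ_apply', trigSeries_dd (finite_support_iterate_dd hc j N), norm_mul,
      ih, pow_succ]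
    ring

instance : IsProbabilityMeasure (volume : Measure UnitAddCircle) :=
  ⟨UnitAddCircle.measure_univ⟩

lemma integral_mFourier {n : ℕ} (ξ : Fin n → ℤ) :
    ∫ t : UnitAddTorus (Fin n), UnitAddTorus.mFourier ξ t = if ξ = 0 then 1 else 0 := by
  split_ifs with h
  · simp [h, UnitAddTorus.mFourier_zero]
  · obtain ⟨j, hj⟩ := Function.ne_iff.mp h
    have h1 := integral_add_right_eq_self (μ := (volume : Measure (UnitAddTorus (Fin n))))
      (fun t => UnitAddTorus.mFourier ξ t)
      (Pi.single j ((1 / 2 / (ξ j : ℝ) : ℝ) : UnitAddCircle))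
    have h2 : ∀ t, UnitAddTorus.mFourier ξ
        (t + Pi.single j ((1 / 2 / (ξ j : ℝ) : ℝ) : UnitAddCircle))
        = - UnitAddTorus.mFourier ξ t := by
      intro t
      simp only [UnitAddTorus.mFourier, ContinuousMap.coe_mk]
      rw [← Finset.mul_prod_erase _ _ (Finset.mem_univ j),
        ← Finset.mul_prod_erase (f := fun i => (fourier (ξ i) (t i) : ℂ)) _ (Finset.mem_univ j)]
      have h3 : ∀ i ∈ Finset.univ.erase j, (fourier (ξ i)
          ((t + (Pi.single j ((1 / 2 / (ξ j : ℝ) : ℝ) : UnitAddCircle) :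
            UnitAddTorus (Fin n))) i) : ℂ)
          = fourier (ξ i) (t i) := by
        intro i hi
        rw [Pi.add_apply, Pi.single_eq_of_ne (Finset.ne_of_mem_erase hi), add_zero]
      rw [Finset.prod_congr rfl h3, Pi.add_apply, Pi.single_eq_same]
      have := fourier_add_half_inv_index (T := 1) (n := ξ j) hj one_pos (t j)
      simp at this ⊢
      rw [this]; ring
    simp only [h2, integral_neg] at h1
    have : (2 : ℂ) * ∫ t : UnitAddTorus (Fin n), UnitAddTorus.mFourier ξ t = 0 := by
      linear_combination -h1
    simpa using this

lemma integral_norm_sq_trigSeries {n : ℕ} {c : (Fin n → ℤ) → ℂ} {S : Finset (Fin n → ℤ)}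
    (hS : ∀ ξ ∉ S, c ξ = 0) : ∫ t, ‖trigSeries c t‖ ^ 2 = ∑ ξ ∈ S, ‖c ξ‖ ^ 2 := by
  have h1 : ∀ t, ((‖trigSeries c t‖ ^ 2 : ℝ) : ℂ)
      = ∑ ξ ∈ S, ∑ η ∈ S, c ξ * starRingEnd ℂ (c η) * UnitAddTorus.mFourier (ξ - η) t := by
    intro t
    rw [Complex.ofReal_pow, ← Complex.mul_conj', trigSeries_eq_sum hS, map_sum, Finset.sum_mul_sum]
    refine Finset.sum_congr rfl fun ξ _ => Finset.sum_congr rfl fun η _ => ?_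
    rw [sub_eq_add_neg, UnitAddTorus.mFourier_add, UnitAddTorus.mFourier_neg, map_mul]
    ring
  have hint : ∀ (a : ℂ) (ξ : Fin n → ℤ), Integrable (fun t : UnitAddTorus (Fin n) =>
      a * UnitAddTorus.mFourier ξ t) := fun a ξ =>
    (by fun_prop : Continuous fun t : UnitAddTorus (Fin n) =>
      a * UnitAddTorus.mFourier ξ t).integrable_of_hasCompactSupport
        (HasCompactSupport.of_compactSpace _)
  rw [← Complex.ofReal_inj, ← integral_complex_ofReal]
  simp_rw [h1]
  rw [integral_finsetSum _ fun ξ _ => integrable_finsetSum _ fun η _ => hint _ _]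
  push_cast
  refine Finset.sum_congr rfl fun ξ hξ => ?_
  rw [integral_finsetSum _ fun η _ => hint _ _]
  simp_rw [integral_const_mul, integral_mFourier, sub_eq_zero]
  simp [hξ, Complex.mul_conj']

/-- The covering map `ℝⁿ → 𝕋ⁿ`. -/
def toTorus {n : ℕ} (x : Fin n → ℝ) : UnitAddTorus (Fin n) := fun i => (x i : UnitAddCircle)

lemma measurePreserving_toTorus (n : ℕ) (a : ℝ) :
    MeasurePreserving (toTorus (n := n))
      (volume.restrict (Set.univ.pi fun _ => Set.Ioc a (a + 1))) volume := by
  rw [volume_pi, Measure.restrict_pi_pi]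
  exact measurePreserving_pi _ _ fun _ => UnitAddCircle.measurePreserving_mk a

lemma continuous_toTorus {n : ℕ} : Continuous (toTorus (n := n)) :=
  continuous_pi fun i => (AddCircle.continuous_mk' (1 : ℝ)).comp (continuous_apply i)

/-- The weight on the torus used to estimate the `L¹` norm of a kernel by `L²` norms. -/
def torusWeight {n : ℕ} (N : ℕ) (r : ℝ) (t : UnitAddTorus (Fin n)) : ℝ :=
  1 + ∑ j, (r⁻¹ * ‖(fourier (-1) (t j) : ℂ) - 1‖) ^ (2 * N)

lemma one_le_torusWeight {n : ℕ} (N : ℕ) (r : ℝ) (t : UnitAddTorus (Fin n)) :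
    1 ≤ torusWeight N r t :=
  le_add_of_nonneg_right (Finset.sum_nonneg fun _ _ => (even_two_mul N).pow_nonneg _)

lemma continuous_torusWeight {n : ℕ} (N : ℕ) (r : ℝ) :
    Continuous (torusWeight (n := n) N r) := by
  unfold torusWeight
  fun_prop

lemma abs_le_norm_fourier_sub_one {x : ℝ} (hx : |x| ≤ 1 / 2) :
    |x| ≤ ‖(fourier (-1) (x : UnitAddCircle) : ℂ) - 1‖ := by
  have h1 : (fourier (-1) (x : UnitAddCircle) : ℂ)
      = Complex.exp (Complex.I * ((-(2 * π * x) : ℝ) : ℂ)) := by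
    rw [fourier_coe_apply]
    congr 1
    push_cast
    ring
  rw [h1, Complex.norm_exp_I_mul_ofReal_sub_one, norm_mul]
  have h2 : |(-(2 * π * x)) / 2| = π * |x| := by
    rw [show (-(2 * π * x)) / 2 = -(π * x) by ring, abs_neg, abs_mul, abs_of_pos pi_pos]
  have h3 := Real.mul_abs_le_abs_sin (x := (-(2 * π * x)) / 2)
    (by rw [h2]; nlinarith [pi_pos])
  rw [h2, show 2 / π * (π * |x|) = 2 * |x| by field_simp] at h3
  simp only [Real.norm_eq_abs, Nat.abs_ofNat]
  linarith [abs_nonneg x]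

lemma inv_torusWeight_le {n : ℕ} (hn : 1 ≤ n) (N : ℕ) {r : ℝ} (hr : 0 < r) {x : Fin n → ℝ}
    (hx : ∀ j, |x j| ≤ 1 / 2) :
    (torusWeight N r (toTorus x))⁻¹ ≤ 2 ^ (2 * N) * (1 + ‖r⁻¹ • x‖) ^ (-(2 * N : ℕ) : ℝ) := by
  have : Nonempty (Fin n) := ⟨⟨0, hn⟩⟩
  obtain ⟨j, hj⟩ : ∃ j, ‖x‖ = |x j| := by
    obtain ⟨j, -, hj⟩ := Finset.exists_mem_eq_sup Finset.univ Finset.univ_nonempty fun j => ‖x j‖₊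
    exact ⟨j, by rw [Pi.norm_def, hj]; rfl⟩
  have h1 : 1 + ‖r⁻¹ • x‖ ^ (2 * N) ≤ torusWeight N r (toTorus x) := by
    unfold torusWeight
    gcongr
    refine le_trans ?_ (Finset.single_le_sum
      (fun _ _ => (even_two_mul N).pow_nonneg _) (Finset.mem_univ j))
    rw [norm_smul, hj, Real.norm_of_nonneg (by positivity)]
    gcongr
    exact abs_le_norm_fourier_sub_one (hx j)
  have h2 : (1 + ‖r⁻¹ • x‖) ^ (2 * N) ≤ 2 ^ (2 * N) * (1 + ‖r⁻¹ • x‖ ^ (2 * N)) := by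
    have := add_pow_le (zero_le_one' ℝ) (norm_nonneg (r⁻¹ • x)) (2 * N)
    rw [one_pow] at this
    refine this.trans ?_
    gcongr
    · norm_num
    · omega
  rw [Real.rpow_neg (by positivity), Real.rpow_natCast, ← div_eq_mul_inv,
    inv_le_comm₀ (by linarith [one_le_torusWeight N r (toTorus x)]) (by positivity), inv_div,
    div_le_iff₀ (by positivity)]
  nlinarith [pow_pos (zero_lt_two' ℝ) (2 * N)]

lemma integrable_of_continuous_torus {n : ℕ} {E : Type*} [NormedAddCommGroup E]
    {f : UnitAddTorus (Fin n) → E} (hf : Continuous f) : Integrable f :=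
  hf.integrable_of_hasCompactSupport (HasCompactSupport.of_compactSpace _)

lemma continuous_inv_torusWeight {n : ℕ} (N : ℕ) (r : ℝ) :
    Continuous fun t : UnitAddTorus (Fin n) => (torusWeight N r t)⁻¹ :=
  (continuous_torusWeight N r).inv₀ fun t => by linarith [one_le_torusWeight N r t]

lemma exists_integral_inv_torusWeight_le {n : ℕ} (hn : 1 ≤ n) {N : ℕ} (hN : n < 2 * N) :
    ∃ B : ℝ, 0 < B ∧ ∀ r : ℝ, 0 < r →
      ∫ t : UnitAddTorus (Fin n), (torusWeight N r t)⁻¹ ≤ B * r ^ n := by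
  have hint : Integrable (fun x : Fin n → ℝ => (1 + ‖x‖) ^ (-(2 * N : ℕ) : ℝ)) :=
    integrable_one_add_norm (by simpa using mod_cast hN)
  set J := ∫ x : Fin n → ℝ, (1 + ‖x‖) ^ (-(2 * N : ℕ) : ℝ) with hJ
  have hJ0 : 0 ≤ J := integral_nonneg fun x => by positivity
  refine ⟨2 ^ (2 * N) * J + 1, by positivity, fun r hr => ?_⟩
  have mp := measurePreserving_toTorus n (-(1 / 2))
  rw [← mp.map_eq, integral_map mp.measurable.aemeasurable
    (continuous_inv_torusWeight N r).aestronglyMeasurable]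
  have hint' : Integrable (fun x : Fin n → ℝ =>
      2 ^ (2 * N) * (1 + ‖r⁻¹ • x‖) ^ (-(2 * N : ℕ) : ℝ)) :=
    ((hint.comp_smul (inv_ne_zero hr.ne'))).const_mul _
  calc ∫ x in Set.univ.pi fun _ => Set.Ioc (-(1 / 2)) (-(1 / 2) + 1),
        (torusWeight N r (toTorus x))⁻¹
      ≤ ∫ x in Set.univ.pi fun _ : Fin n => Set.Ioc (-(1 / 2) : ℝ) (-(1 / 2) + 1),
          2 ^ (2 * N) * (1 + ‖r⁻¹ • x‖) ^ (-(2 * N : ℕ) : ℝ) := by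
        refine setIntegral_mono_on ?_ hint'.integrableOn
          (MeasurableSet.univ_pi fun _ => measurableSet_Ioc) fun x hx => ?_
        · exact mp.integrable_comp_of_integrable
            (integrable_of_continuous_torus (continuous_inv_torusWeight N r))
        · refine inv_torusWeight_le hn N hr fun j => ?_
          have := hx j (Set.mem_univ j)
          rw [abs_le]
          constructor <;> linarith [this.1, this.2]
    _ ≤ ∫ x : Fin n → ℝ, 2 ^ (2 * N) * (1 + ‖r⁻¹ • x‖) ^ (-(2 * N : ℕ) : ℝ) :=
        setIntegral_le_integral hint' (Filter.Eventually.of_forall fun x => by positivity)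
    _ = 2 ^ (2 * N) * J * r ^ n := by
        rw [integral_const_mul, Measure.integral_comp_smul volume
          (fun x : Fin n → ℝ => (1 + ‖x‖) ^ (-(2 * N : ℕ) : ℝ)) r⁻¹]
        simp only [Module.finrank_fintype_fun_eq_card, Fintype.card_fin, smul_eq_mul, inv_pow,
          inv_inv, abs_of_pos (pow_pos hr n)]
        ring
    _ ≤ _ := by
        gcongr
        linarith

lemma integral_norm_trigSeries_le {n : ℕ} {c : (Fin n → ℤ) → ℂ} {S : Finset (Fin n → ℤ)} {N : ℕ}
    (hS : ∀ ξ ∉ S, c ξ = 0) (hS' : ∀ j, ∀ ξ ∉ S, (dd j)^[N] c ξ = 0) (r : ℝ) {s : ℝ}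
    (hs : 0 < s) :
    ∫ t, ‖trigSeries c t‖ ≤
      (s * (∑ ξ ∈ S, ‖c ξ‖ ^ 2 + ∑ j, r⁻¹ ^ (2 * N) * ∑ ξ ∈ S, ‖(dd j)^[N] c ξ‖ ^ 2)
        + s⁻¹ * ∫ t : UnitAddTorus (Fin n), (torusWeight N r t)⁻¹) / 2 := by
  have hc : c.support.Finite := S.finite_toSet.subset fun ξ h => by
    by_contra h'
    exact h (hS ξ h')
  have h1 : ∀ t, torusWeight N r t * ‖trigSeries c t‖ ^ 2 = ‖trigSeries c t‖ ^ 2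
      + ∑ j, r⁻¹ ^ (2 * N) * ‖trigSeries ((dd j)^[N] c) t‖ ^ 2 := by
    intro t
    rw [torusWeight, add_mul, one_mul, Finset.sum_mul]
    congr 1
    refine Finset.sum_congr rfl fun j _ => ?_
    rw [norm_trigSeries_iterate_dd hc]
    ring
  have hd : ∀ j, Integrable fun t => r⁻¹ ^ (2 * N) * ‖trigSeries ((dd j)^[N] c) t‖ ^ 2 := fun j =>
    integrable_of_continuous_torus (continuous_const.mul
      ((continuous_trigSeries (finite_support_iterate_dd hc j N)).norm.pow 2))
  have hP : Integrable fun t => ‖trigSeries c t‖ ^ 2 :=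
    integrable_of_continuous_torus ((continuous_trigSeries hc).norm.pow 2)
  have h2 : ∫ t, torusWeight N r t * ‖trigSeries c t‖ ^ 2 =
      ∑ ξ ∈ S, ‖c ξ‖ ^ 2 + ∑ j, r⁻¹ ^ (2 * N) * ∑ ξ ∈ S, ‖(dd j)^[N] c ξ‖ ^ 2 := by
    simp_rw [h1]
    rw [integral_add hP
      (integrable_finsetSum _ fun j _ => hd j), integral_norm_sq_trigSeries hS,
      integral_finsetSum _ fun j _ => hd j]
    simp_rw [integral_const_mul]
    congr 1
    exact Finset.sum_congr rfl fun j _ => by rw [integral_norm_sq_trigSeries (hS' j)]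
  have hW : Integrable fun t => s * (torusWeight N r t * ‖trigSeries c t‖ ^ 2) :=
    (integrable_of_continuous_torus ((continuous_torusWeight N r).mul
      ((continuous_trigSeries hc).norm.pow 2))).const_mul s
  have hI : Integrable fun t : UnitAddTorus (Fin n) => s⁻¹ * (torusWeight N r t)⁻¹ :=
    (integrable_of_continuous_torus (continuous_inv_torusWeight N r)).const_mul _
  rw [← h2, ← integral_const_mul, ← integral_const_mul, ← integral_add hW hI, ← integral_div]
  refine integral_mono (integrable_of_continuous_torus (continuous_trigSeries hc).norm)
    ((hW.add hI).div_const 2) fun t => ?_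
  have hw : 0 < torusWeight N r t := by linarith [one_le_torusWeight N r t]
  have h3 : s * (torusWeight N r t * ‖trigSeries c t‖ ^ 2) + s⁻¹ * (torusWeight N r t)⁻¹
      - 2 * ‖trigSeries c t‖
      = (s * torusWeight N r t * ‖trigSeries c t‖ - 1) ^ 2 * (s⁻¹ * (torusWeight N r t)⁻¹) := by
    field_simp
    ring
  have h4 : 0 ≤ (s * torusWeight N r t * ‖trigSeries c t‖ - 1) ^ 2
      * (s⁻¹ * (torusWeight N r t)⁻¹) := by positivity
  dsimp only
  linarith

lemma pdM_single {n : ℕ} (j : Fin n) (m : ℕ) (f : (Fin n → ℝ) → ℂ) :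
    pdM (Pi.single j m) f = (pd j)^[m] f := by
  have h0 : ∀ L : List (Fin n), j ∉ L →
      (L.flatMap fun i => List.replicate ((Pi.single j m : Fin n → ℕ) i) i) = [] := by
    intro L hL
    rw [List.flatMap_eq_nil_iff]
    intro i hi
    rw [Pi.single_eq_of_ne (by rintro rfl; exact hL hi), List.replicate_zero]
  have h1 : ∀ L : List (Fin n), L.Nodup → j ∈ L →
      (L.flatMap fun i => List.replicate ((Pi.single j m : Fin n → ℕ) i) i)
        = List.replicate m j := by
    intro L
    induction L with
    | nil => simp
    | cons a L ih =>
      intro hnd hj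
      rw [List.nodup_cons] at hnd
      rw [List.flatMap_cons]
      by_cases haj : a = j
      · subst haj
        rw [h0 L hnd.1, Pi.single_eq_same, List.append_nil]
      · rw [Pi.single_eq_of_ne haj, List.replicate_zero, List.nil_append]
        exact ih hnd.2 ((List.mem_cons.mp hj).resolve_left (Ne.symm haj))
  rw [pdM, mIdxList, h1 _ (List.nodup_finRange n) (List.mem_finRange j)]
  clear h0 h1
  induction m with
  | zero => rfl
  | succ m ih =>
    rw [List.replicate_succ, List.foldr_cons, Function.iterate_succ_apply', ih]

lemma contDiff_pd {n : ℕ} {f : (Fin n → ℝ) → ℂ} (hf : ContDiff ℝ (⊤ : ℕ∞) f) (j : Fin n) :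
    ContDiff ℝ (⊤ : ℕ∞) (pd j f) :=
  (hf.fderiv_right (m := ((⊤ : ℕ∞) : WithTop ℕ∞)) (by simp)).clm_apply contDiff_const

lemma contDiff_iterate_pd {n : ℕ} {f : (Fin n → ℝ) → ℂ} (hf : ContDiff ℝ (⊤ : ℕ∞) f)
    (j : Fin n) (m : ℕ) : ContDiff ℝ (⊤ : ℕ∞) ((pd j)^[m] f) := by
  induction m with
  | zero => exact hf
  | succ m ih => rw [Function.iterate_succ_apply']; exact contDiff_pd ih j

lemma differentiable_of_contDiff_top {n : ℕ} {f : (Fin n → ℝ) → ℂ}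
    (hf : ContDiff ℝ (⊤ : ℕ∞) f) : Differentiable ℝ f :=
  hf.differentiable (by simp)

lemma pd_add {n : ℕ} {f g : (Fin n → ℝ) → ℂ} (hf : ContDiff ℝ (⊤ : ℕ∞) f)
    (hg : ContDiff ℝ (⊤ : ℕ∞) g) (j : Fin n) : pd j (f + g) = pd j f + pd j g := by
  funext x
  simp [pd, fderiv_add (differentiable_of_contDiff_top hf x) (differentiable_of_contDiff_top hg x)]

lemma iterate_pd_add {n : ℕ} {f g : (Fin n → ℝ) → ℂ} (hf : ContDiff ℝ (⊤ : ℕ∞) f)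
    (hg : ContDiff ℝ (⊤ : ℕ∞) g) (j : Fin n) (m : ℕ) :
    (pd j)^[m] (f + g) = (pd j)^[m] f + (pd j)^[m] g := by
  induction m generalizing f g with
  | zero => rfl
  | succ m ih =>
    simp only [Function.iterate_succ_apply, pd_add hf hg, ih (contDiff_pd hf j) (contDiff_pd hg j)]

lemma pd_sub {n : ℕ} {f g : (Fin n → ℝ) → ℂ} (hf : ContDiff ℝ (⊤ : ℕ∞) f)
    (hg : ContDiff ℝ (⊤ : ℕ∞) g) (j : Fin n) : pd j (f - g) = pd j f - pd j g := by
  funext x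
  simp [pd, fderiv_sub (differentiable_of_contDiff_top hf x) (differentiable_of_contDiff_top hg x)]

lemma pd_mul {n : ℕ} {f g : (Fin n → ℝ) → ℂ} (hf : ContDiff ℝ (⊤ : ℕ∞) f)
    (hg : ContDiff ℝ (⊤ : ℕ∞) g) (j : Fin n) : pd j (f * g) = pd j f * g + f * pd j g := by
  funext x
  simp [pd, fderiv_mul (differentiable_of_contDiff_top hf x) (differentiable_of_contDiff_top hg x)]
  ring

lemma norm_iterate_pd_mul_le {n : ℕ} (j : Fin n) (x : Fin n → ℝ) (q : ℝ) (m : ℕ) :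
    ∀ {f g : (Fin n → ℝ) → ℂ} {F G : ℝ}, ContDiff ℝ (⊤ : ℕ∞) f → ContDiff ℝ (⊤ : ℕ∞) g →
      (∀ i ≤ m, ‖(pd j)^[i] f x‖ ≤ F * q ^ i) → (∀ i ≤ m, ‖(pd j)^[i] g x‖ ≤ G * q ^ i) →
      ‖(pd j)^[m] (f * g) x‖ ≤ 2 ^ m * F * G * q ^ m := by
  induction m with
  | zero =>
    intro f g F G _ _ hF hG
    have h1 := hF 0 le_rfl
    have h2 := hG 0 le_rfl
    simp only [Function.iterate_zero, id_eq, pow_zero, mul_one, one_mul, Pi.mul_apply,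
      norm_mul] at h1 h2 ⊢
    exact mul_le_mul h1 h2 (norm_nonneg _) ((norm_nonneg _).trans h1)
  | succ m ih =>
    intro f g F G hf hg hF hG
    rw [Function.iterate_succ_apply, pd_mul hf hg,
      iterate_pd_add (f := pd j f * g) (g := f * pd j g) ((contDiff_pd hf j).mul hg)
        (hf.mul (contDiff_pd hg j)), Pi.add_apply]
    have h1 := ih (F := F * q) (G := G) (contDiff_pd hf j) hg (fun i hi => by
        rw [← Function.iterate_succ_apply, mul_assoc, ← pow_succ']
        exact hF _ (by omega)) fun i hi => hG i (by omega)
    have h2 := ih (F := F) (G := G * q) hf (contDiff_pd hg j) (fun i hi => hF i (by omega))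
      fun i hi => by
        rw [← Function.iterate_succ_apply, mul_assoc, ← pow_succ']
        exact hG _ (by omega)
    refine (norm_add_le _ _).trans ((add_le_add h1 h2).trans (le_of_eq ?_))
    ring

lemma iterate_pd_comp_smul {n : ℕ} (f : (Fin n → ℝ) → ℂ) (a : ℝ) (j : Fin n) (m : ℕ) :
    (pd j)^[m] (fun x => f (a • x)) = fun x => (a : ℂ) ^ m * (pd j)^[m] f (a • x) := by
  induction m with
  | zero => simp
  | succ m ih =>
    rw [Function.iterate_succ_apply', ih, Function.iterate_succ_apply']
    funext x
    change fderiv ℝ ((a : ℂ) ^ m • fun x => (pd j)^[m] f (a • x)) x (Pi.single j 1) = _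
    rw [fderiv_const_smul_field, Pi.smul_apply, fderiv_comp_smul]
    simp [pd, pow_succ, mul_assoc]

lemma iterate_pd_eq_zero_of_isOpen {n : ℕ} {f : (Fin n → ℝ) → ℂ} {U : Set (Fin n → ℝ)}
    (hU : IsOpen U) (hf : ∀ x ∈ U, f x = 0) (j : Fin n) (m : ℕ) :
    ∀ x ∈ U, (pd j)^[m] f x = 0 := by
  induction m with
  | zero => exact hf
  | succ m ih =>
    intro x hx
    have : (pd j)^[m] f =ᶠ[nhds x] fun _ => 0 := by
      filter_upwards [hU.mem_nhds hx] with y hy using ih y hy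
    rw [Function.iterate_succ_apply', pd, this.fderiv_eq]
    simp

lemma exists_norm_iterate_pd_le {n : ℕ} {f : (Fin n → ℝ) → ℂ} (hf : ContDiff ℝ (⊤ : ℕ∞) f)
    (hsupp : HasCompactSupport f) (N : ℕ) :
    ∃ B : ℝ, 0 < B ∧ ∀ m ≤ N, ∀ j x, ‖(pd j)^[m] f x‖ ≤ B := by
  have h1 : ∀ (m : ℕ) (j : Fin n), ∃ B : ℝ, 0 ≤ B ∧ ∀ x, ‖(pd j)^[m] f x‖ ≤ B := by
    intro m j
    have hc : HasCompactSupport ((pd j)^[m] f) := by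
      refine HasCompactSupport.intro hsupp fun x hx => ?_
      exact iterate_pd_eq_zero_of_isOpen (isClosed_tsupport f).isOpen_compl
        (fun y hy => image_eq_zero_of_notMem_tsupport hy) j m x hx
    obtain ⟨B, hB⟩ := hc.exists_bound_of_continuous (contDiff_iterate_pd hf j m).continuous
    exact ⟨B, (norm_nonneg _).trans (hB 0), hB⟩
  choose B hB0 hB using h1
  refine ⟨∑ m ∈ Finset.range (N + 1), ∑ j, B m j + 1,
    add_pos_of_nonneg_of_pos (Finset.sum_nonneg fun m _ => Finset.sum_nonneg fun j _ => hB0 m j)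
      one_pos, fun m hm j x => (hB m j x).trans ?_⟩
  have h2 : B m j ≤ ∑ j, B m j :=
    Finset.single_le_sum (fun j _ => hB0 m j) (Finset.mem_univ j)
  have h3 : ∑ j, B m j ≤ ∑ m ∈ Finset.range (N + 1), ∑ j, B m j :=
    Finset.single_le_sum (f := fun m => ∑ j, B m j)
      (fun m _ => Finset.sum_nonneg fun j _ => hB0 m j) (Finset.mem_range.mpr (by omega))
  linarith

lemma norm_sub_le_of_norm_pd_le {n : ℕ} {f : (Fin n → ℝ) → ℂ} (hf : ContDiff ℝ (⊤ : ℕ∞) f)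
    {j : Fin n} {M : ℝ} (hM : ∀ x, ‖pd j f x‖ ≤ M) (x : Fin n → ℝ) :
    ‖f (x + Pi.single j 1) - f x‖ ≤ M := by
  have h1 : ∀ t ∈ Set.Icc (0 : ℝ) 1, HasDerivWithinAt
      (fun t : ℝ => f (x + t • Pi.single j (1 : ℝ))) (pd j f (x + t • Pi.single j (1 : ℝ)))
      (Set.Icc 0 1) t := by
    intro t _
    have h2 : HasDerivAt (fun t : ℝ => x + t • (Pi.single j (1 : ℝ) : Fin n → ℝ))
        (Pi.single j 1) t := by
      simpa using ((hasDerivAt_id t).smul_const (Pi.single j (1 : ℝ) : Fin n → ℝ)).const_add x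
    exact ((differentiable_of_contDiff_top hf _).hasFDerivAt.comp_hasDerivAt t h2).hasDerivWithinAt
  simpa using norm_image_sub_le_of_norm_deriv_le_segment_01' h1 fun t _ => hM _

lemma iterate_pd_comp_add {n : ℕ} (f : (Fin n → ℝ) → ℂ) (v : Fin n → ℝ) (j : Fin n) (m : ℕ) :
    (pd j)^[m] (fun x => f (x + v)) = fun x => (pd j)^[m] f (x + v) := by
  induction m with
  | zero => rfl
  | succ m ih =>
    rw [Function.iterate_succ_apply', ih, Function.iterate_succ_apply']
    funext x
    simp only [pd, fderiv_comp_add_right]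

lemma iterate_pd_sub {n : ℕ} {f g : (Fin n → ℝ) → ℂ} (hf : ContDiff ℝ (⊤ : ℕ∞) f)
    (hg : ContDiff ℝ (⊤ : ℕ∞) g) (j : Fin n) (m : ℕ) :
    (pd j)^[m] (f - g) = (pd j)^[m] f - (pd j)^[m] g := by
  induction m generalizing f g with
  | zero => rfl
  | succ m ih =>
    simp only [Function.iterate_succ_apply, pd_sub hf hg, ih (contDiff_pd hf j) (contDiff_pd hg j)]

lemma castZ_add_single {n : ℕ} (ξ : Fin n → ℤ) (j : Fin n) :
    castZ (ξ + Pi.single j 1) = castZ ξ + Pi.single j 1 := by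
  funext i
  by_cases h : i = j
  · subst h; simp [castZ]
  · simp [castZ, Pi.single_eq_of_ne h]

lemma norm_iterate_dd_le {n : ℕ} (j : Fin n) {M : ℝ} (N : ℕ) :
    ∀ {f : (Fin n → ℝ) → ℂ}, ContDiff ℝ (⊤ : ℕ∞) f → (∀ x, ‖(pd j)^[N] f x‖ ≤ M) →
      ∀ ξ, ‖(dd j)^[N] (fun ξ => f (castZ ξ)) ξ‖ ≤ M := by
  induction N with
  | zero => exact fun _ hM ξ => hM (castZ ξ)
  | succ N ih =>
    intro f hf hM ξ
    have hs : ContDiff ℝ (⊤ : ℕ∞) fun x : Fin n → ℝ => f (x + Pi.single j 1) :=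
      hf.comp (contDiff_id.add contDiff_const)
    rw [Function.iterate_succ_apply]
    have h1 : dd j (fun ξ => f (castZ ξ)) =
        fun ξ => ((fun x : Fin n → ℝ => f (x + Pi.single j 1)) - f) (castZ ξ) := by
      funext ξ
      simp only [dd, castZ_add_single, Pi.sub_apply]
    rw [h1]
    refine ih (f := (fun x : Fin n → ℝ => f (x + Pi.single j 1)) - f) (hs.sub hf) (fun x => ?_) ξ
    rw [iterate_pd_sub hs hf, iterate_pd_comp_add, Pi.sub_apply]
    refine norm_sub_le_of_norm_pd_le (contDiff_iterate_pd hf j N) (fun y => ?_) x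
    have := hM y
    rwa [Function.iterate_succ_apply'] at this

/-- The lattice points of the box `[-L, L]ⁿ`. -/
def latticeBox (n L : ℕ) : Finset (Fin n → ℤ) :=
  Fintype.piFinset fun _ => Finset.Icc (-(L : ℤ)) L

lemma mem_latticeBox {n L : ℕ} {ξ : Fin n → ℤ} : ξ ∈ latticeBox n L ↔ ∀ i, |ξ i| ≤ L := by
  simp [latticeBox, abs_le]

lemma card_latticeBox (n L : ℕ) : (latticeBox n L).card = (2 * L + 1) ^ n := by
  rw [latticeBox, Fintype.card_piFinset]
  simp only [Int.card_Icc, Finset.prod_const, Finset.card_univ, Fintype.card_fin]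
  congr 1
  omega

lemma iterate_dd_eq_zero {n L : ℕ} {c : (Fin n → ℤ) → ℂ} (hc : ∀ ξ ∉ latticeBox n L, c ξ = 0)
    (j : Fin n) (N : ℕ) : ∀ ξ ∉ latticeBox n (L + N), (dd j)^[N] c ξ = 0 := by
  induction N with
  | zero => exact hc
  | succ N ih =>
    intro ξ hξ
    rw [Function.iterate_succ_apply', dd, ih, ih, sub_zero]
    all_goals
      contrapose! hξ
      rw [mem_latticeBox] at hξ ⊢
      intro i
      have := hξ i
      push_cast at this ⊢
    · linarith
    · by_cases hij : i = j
      · subst hij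
        simp only [Pi.add_apply, Pi.single_eq_same] at this
        rw [abs_le] at this ⊢
        constructor <;> linarith
      · simp only [Pi.add_apply, Pi.single_eq_of_ne hij, add_zero] at this
        linarith

lemma exists_integral_norm_trigSeries_le {n N : ℕ} (hn : 1 ≤ n) (hN : n < 2 * N) :
    ∃ A : ℝ, 0 < A ∧ ∀ (k : ℕ) (f : (Fin n → ℝ) → ℂ) (u v a : ℝ), ContDiff ℝ (⊤ : ℕ∞) f →
      0 < u → 0 < a → ((2 : ℝ) ^ k) ^ n * v ^ 2 * u ^ n = 1 →
      (∀ x, 4 * 2 ^ k < ‖x‖ → f x = 0) → (∀ x, ‖f x‖ ≤ a * v) →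
      (∀ j x, ‖(pd j)^[N] f x‖ ≤ a * v * u ^ N) →
      ∫ t, ‖trigSeries (fun ξ => f (castZ ξ)) t‖ ≤ A * a := by
  obtain ⟨B, hB0, hB⟩ := exists_integral_inv_torusWeight_le hn hN
  set D : ℝ := (9 + 2 * N) ^ n with hD
  refine ⟨((1 + n) * D + B) / 2, by positivity,
    fun k f u v a hf hu ha huv hsupp h0 hder => ?_⟩
  set c : (Fin n → ℤ) → ℂ := fun ξ => f (castZ ξ) with hc
  set S := latticeBox n (4 * 2 ^ k + N) with hS
  have hc0 : ∀ ξ ∉ latticeBox n (4 * 2 ^ k), c ξ = 0 := by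
    intro ξ hξ
    apply hsupp
    rw [mem_latticeBox] at hξ
    push Not at hξ
    obtain ⟨i, hi⟩ := hξ
    refine lt_of_lt_of_le ?_ (norm_le_pi_norm (castZ ξ) i)
    rw [castZ, Real.norm_eq_abs]
    exact_mod_cast hi
  have hcS : ∀ ξ ∉ S, c ξ = 0 := fun ξ hξ => hc0 ξ fun h => hξ <| by
    rw [hS, mem_latticeBox]
    rw [mem_latticeBox] at h
    intro i
    have := h i
    push_cast at this ⊢
    linarith
  have hcard : (S.card : ℝ) ≤ D * ((2 : ℝ) ^ k) ^ n := by
    rw [hS, card_latticeBox, hD, ← mul_pow]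
    push_cast
    have : (1 : ℝ) ≤ 2 ^ k := one_le_pow₀ one_le_two
    gcongr
    have hN0 : (0 : ℝ) ≤ N := N.cast_nonneg
    nlinarith
  set Q : ℝ := D * ((2 : ℝ) ^ k) ^ n * (a * v) ^ 2 with hQ
  have hsum : ∀ (d : (Fin n → ℤ) → ℂ) (M : ℝ), (∀ ξ, ‖d ξ‖ ≤ M) →
      ∑ ξ ∈ S, ‖d ξ‖ ^ 2 ≤ D * ((2 : ℝ) ^ k) ^ n * M ^ 2 := by
    intro d M hM
    calc ∑ ξ ∈ S, ‖d ξ‖ ^ 2 ≤ ∑ ξ ∈ S, M ^ 2 := by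
          refine Finset.sum_le_sum fun ξ _ => ?_
          gcongr
          exact hM ξ
      _ = S.card * M ^ 2 := by rw [Finset.sum_const, nsmul_eq_mul]
      _ ≤ _ := by gcongr
  have h1 : ∑ ξ ∈ S, ‖c ξ‖ ^ 2 ≤ Q := hsum c _ fun ξ => h0 _
  have h2 : ∀ j, u⁻¹ ^ (2 * N) * ∑ ξ ∈ S, ‖(dd j)^[N] c ξ‖ ^ 2 ≤ Q := by
    intro j
    calc u⁻¹ ^ (2 * N) * ∑ ξ ∈ S, ‖(dd j)^[N] c ξ‖ ^ 2
        ≤ u⁻¹ ^ (2 * N) * (D * ((2 : ℝ) ^ k) ^ n * (a * v * u ^ N) ^ 2) := by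
          gcongr
          exact hsum _ _ fun ξ => norm_iterate_dd_le j N hf (hder j) ξ
      _ = Q * (u⁻¹ ^ (2 * N) * u ^ (2 * N)) := by rw [hQ]; ring
      _ = Q := by rw [← mul_pow, inv_mul_cancel₀ hu.ne', one_pow, mul_one]
  have h3 : ∑ ξ ∈ S, ‖c ξ‖ ^ 2 + ∑ j, u⁻¹ ^ (2 * N) * ∑ ξ ∈ S, ‖(dd j)^[N] c ξ‖ ^ 2
      ≤ (1 + n) * Q := by
    have := Finset.sum_le_sum fun j (_ : j ∈ Finset.univ) => h2 j
    rw [Finset.sum_const, Finset.card_univ, Fintype.card_fin, nsmul_eq_mul] at this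
    linarith
  have hs : 0 < u ^ n / a := by positivity
  refine (integral_norm_trigSeries_le hcS (fun j => iterate_dd_eq_zero hc0 j N) u hs).trans ?_
  calc (u ^ n / a * (∑ ξ ∈ S, ‖c ξ‖ ^ 2
        + ∑ j, u⁻¹ ^ (2 * N) * ∑ ξ ∈ S, ‖(dd j)^[N] c ξ‖ ^ 2)
        + (u ^ n / a)⁻¹ * ∫ t : UnitAddTorus (Fin n), (torusWeight N u t)⁻¹) / 2
      ≤ (u ^ n / a * ((1 + n) * Q) + (u ^ n / a)⁻¹ * (B * u ^ n)) / 2 := by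
        gcongr
        exact hB u hu
    _ = ((1 + n) * D * a * (((2 : ℝ) ^ k) ^ n * v ^ 2 * u ^ n) + B * a) / 2 := by
        rw [hQ]
        field_simp
    _ = _ := by rw [huv]; ring

lemma exists_cutoff (n : ℕ) : ∃ χ : (Fin n → ℝ) → ℂ, ContDiff ℝ (⊤ : ℕ∞) χ ∧
    (∀ x, ‖x‖ ≤ 1 → χ x = 1) ∧ ∀ x, 2 ≤ ‖x‖ → χ x = 0 := by
  let b : ContDiffBump (0 : Fin n → ℝ) := ⟨1, 2, one_pos, one_lt_two⟩
  refine ⟨fun x => (b x : ℂ), Complex.ofRealCLM.contDiff.comp b.contDiff, fun x hx => ?_,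
    fun x hx => ?_⟩
  · simp [b.one_of_mem_closedBall (mem_closedBall_zero_iff.mpr hx)]
  · simp [b.zero_of_le_dist (by simpa using hx)]

lemma norm_le_jbR {n : ℕ} (ξ : Fin n → ℝ) : ‖ξ‖ ≤ jbR ξ := by
  rw [jbR, pi_norm_le_iff_of_nonneg (Real.sqrt_nonneg _)]
  intro i
  rw [Real.norm_eq_abs, ← Real.sqrt_sq_eq_abs]
  apply Real.sqrt_le_sqrt
  have := Finset.single_le_sum (f := fun j => ξ j ^ 2) (fun j _ => sq_nonneg _)
    (Finset.mem_univ i)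
  linarith

/-- The dyadic piece `χ(2^{-k-1}ξ) - χ(2^{-k}ξ)` built from a cutoff `χ`. -/
def dyadicCutoff {n : ℕ} (χ : (Fin n → ℝ) → ℂ) (k : ℕ) (x : Fin n → ℝ) : ℂ :=
  χ (((2 : ℝ) ^ (k + 1))⁻¹ • x) - χ (((2 : ℝ) ^ k)⁻¹ • x)

lemma contDiff_dyadicCutoff {n : ℕ} {χ : (Fin n → ℝ) → ℂ} (hχ : ContDiff ℝ (⊤ : ℕ∞) χ) (k : ℕ) :
    ContDiff ℝ (⊤ : ℕ∞) (dyadicCutoff χ k) :=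
  (hχ.comp (contDiff_id.const_smul _)).sub (hχ.comp (contDiff_id.const_smul _))

lemma dyadicCutoff_eq_zero {n : ℕ} {χ : (Fin n → ℝ) → ℂ} (h1 : ∀ x, ‖x‖ ≤ 1 → χ x = 1)
    (h2 : ∀ x, 2 ≤ ‖x‖ → χ x = 0) {k : ℕ} {x : Fin n → ℝ}
    (hx : ‖x‖ < 2 ^ k ∨ 4 * 2 ^ k < ‖x‖) : dyadicCutoff χ k x = 0 := by
  have hk : (0 : ℝ) < 2 ^ k := by positivity
  have hnorm : ∀ m : ℕ, ‖((2 : ℝ) ^ m)⁻¹ • x‖ = ‖x‖ / 2 ^ m := fun m => by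
    rw [norm_smul, Real.norm_of_nonneg (by positivity), div_eq_inv_mul]
  rw [dyadicCutoff]
  rcases hx with hx | hx
  · rw [h1, h1, sub_self] <;> rw [hnorm, div_le_one (by positivity)]
    · exact hx.le
    · rw [pow_succ]; linarith
  · rw [h2, h2, sub_self] <;> rw [hnorm, le_div_iff₀ (by positivity)]
    · linarith
    · rw [pow_succ]; linarith

lemma exists_norm_iterate_pd_dyadicCutoff_le {n : ℕ} {χ : (Fin n → ℝ) → ℂ}
    (hχ : ContDiff ℝ (⊤ : ℕ∞) χ) (h2 : ∀ x, 2 ≤ ‖x‖ → χ x = 0) (N : ℕ) :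
    ∃ B : ℝ, 0 < B ∧ ∀ k, ∀ m ≤ N, ∀ j x,
      ‖(pd j)^[m] (dyadicCutoff χ k) x‖ ≤ B * ((2 : ℝ) ^ k)⁻¹ ^ m := by
  have hsupp : HasCompactSupport χ := by
    refine HasCompactSupport.intro (isCompact_closedBall 0 2) fun x hx => h2 x ?_
    rw [mem_closedBall_zero_iff, not_le] at hx
    exact hx.le
  have hs : ∀ k : ℕ, ContDiff ℝ (⊤ : ℕ∞) fun x : Fin n → ℝ => χ (((2 : ℝ) ^ k)⁻¹ • x) :=
    fun k => hχ.comp (contDiff_id.const_smul _)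
  obtain ⟨B, hB0, hB⟩ := exists_norm_iterate_pd_le hχ hsupp N
  have hb : ∀ k : ℕ, ∀ m ≤ N, ∀ j x, ‖(pd j)^[m] (fun x => χ (((2 : ℝ) ^ k)⁻¹ • x)) x‖
      ≤ B * ((2 : ℝ) ^ k)⁻¹ ^ m := by
    intro k m hm j x
    rw [iterate_pd_comp_smul, norm_mul, norm_pow, Complex.norm_real,
      Real.norm_of_nonneg (by positivity), mul_comm]
    gcongr
    exact hB m hm j _
  refine ⟨2 * B, by positivity, fun k m hm j x => ?_⟩
  have heq : dyadicCutoff χ k = (fun x => χ (((2 : ℝ) ^ (k + 1))⁻¹ • x))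
      - fun x => χ (((2 : ℝ) ^ k)⁻¹ • x) := rfl
  rw [heq, iterate_pd_sub (hs _) (hs _), Pi.sub_apply]
  refine (norm_sub_le _ _).trans ((add_le_add (hb _ m hm j x) (hb _ m hm j x)).trans ?_)
  have : ((2 : ℝ) ^ (k + 1))⁻¹ ^ m ≤ ((2 : ℝ) ^ k)⁻¹ ^ m := by
    gcongr
    · norm_num
    · omega
  nlinarith

lemma exists_norm_iterate_pd_dyadic_le {n N : ℕ} {ε ρ C : ℝ} (hε : 0 ≤ ε) (hρ0 : 0 ≤ ρ)
    (hρ1 : ρ ≤ 1) (hC : 0 < C) {ω : ℝ → ℝ} (hω_nonneg : ∀ t, 0 ≤ t → 0 ≤ ω t)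
    (hω_mono : MonotoneOn ω (Set.Ici (0 : ℝ))) {σ χ : (Fin n → ℝ) → ℂ}
    (hσs : ContDiff ℝ (⊤ : ℕ∞) σ)
    (hσ : ∀ j, ∀ m ≤ N, ∀ ξ, ‖(pd j)^[m] σ ξ‖ ≤
      C * ω (jbR ξ ^ (-ε)) * jbR ξ ^ (-((n : ℝ) / 2) * (1 - ρ) - ρ * m))
    (hχ : ContDiff ℝ (⊤ : ℕ∞) χ) (h1 : ∀ x, ‖x‖ ≤ 1 → χ x = 1) (h2 : ∀ x, 2 ≤ ‖x‖ → χ x = 0) :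
    ∃ B : ℝ, 0 < B ∧ ∀ k : ℕ, ∀ m ≤ N, ∀ j x, ‖(pd j)^[m] (σ * dyadicCutoff χ k) x‖ ≤
      B * ω (((2 : ℝ) ^ k) ^ (-ε)) * ((2 : ℝ) ^ k) ^ (-((n : ℝ) / 2) * (1 - ρ))
        * (((2 : ℝ) ^ k) ^ (-ρ)) ^ m := by
  obtain ⟨B, hB0, hB⟩ := exists_norm_iterate_pd_dyadicCutoff_le hχ h2 N
  refine ⟨2 ^ N * C * B, by positivity, fun k m hm j x => ?_⟩
  set R : ℝ := 2 ^ k with hR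
  have hR1 : 1 ≤ R := one_le_pow₀ one_le_two
  have hR0 : 0 < R := by positivity
  have hωR : 0 ≤ ω (R ^ (-ε)) := hω_nonneg _ (by positivity)
  by_cases hx : ‖x‖ < R ∨ 4 * R < ‖x‖
  · have hU : IsOpen {x : Fin n → ℝ | ‖x‖ < R ∨ 4 * R < ‖x‖} :=
      (isOpen_lt continuous_norm continuous_const).union
        (isOpen_lt continuous_const continuous_norm)
    rw [iterate_pd_eq_zero_of_isOpen hU (fun y hy => by
      rw [Pi.mul_apply, dyadicCutoff_eq_zero h1 h2 hy, mul_zero]) j m x hx, norm_zero]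
    positivity
  · push Not at hx
    have hJ : R ≤ jbR x := hx.1.trans (norm_le_jbR x)
    have h3 : ∀ i ≤ m, ‖(pd j)^[i] σ x‖ ≤
        C * ω (R ^ (-ε)) * R ^ (-((n : ℝ) / 2) * (1 - ρ)) * (R ^ (-ρ)) ^ i := by
      intro i hi
      refine (hσ j i (hi.trans hm) x).trans ?_
      rw [mul_assoc (C * ω _), ← Real.rpow_natCast (R ^ (-ρ)), ← Real.rpow_mul hR0.le,
        ← Real.rpow_add hR0]
      have h4 : jbR x ^ (-ε) ≤ R ^ (-ε) :=
        Real.rpow_le_rpow_of_nonpos hR0 hJ (by linarith)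
      have h5 : ω (jbR x ^ (-ε)) ≤ ω (R ^ (-ε)) :=
        hω_mono (Real.rpow_nonneg (hR0.le.trans hJ) _) (Real.rpow_nonneg hR0.le _) h4
      have h6 : -((n : ℝ) / 2) * (1 - ρ) - ρ * i = -((n : ℝ) / 2) * (1 - ρ) + -ρ * i := by ring
      rw [h6]
      have h7 : -((n : ℝ) / 2) * (1 - ρ) + -ρ * i ≤ 0 := by
        have : 0 ≤ (n : ℝ) / 2 * (1 - ρ) := mul_nonneg (by positivity) (by linarith)
        have : 0 ≤ ρ * i := by positivity
        linarith
      have h8 := Real.rpow_le_rpow_of_nonpos hR0 hJ h7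
      gcongr
      exact Real.rpow_nonneg (hR0.le.trans hJ) _
    have h4 : ∀ i ≤ m, ‖(pd j)^[i] (dyadicCutoff χ k) x‖ ≤ B * (R ^ (-ρ)) ^ i := by
      intro i hi
      refine (hB k i (hi.trans hm) j x).trans ?_
      gcongr
      rw [← Real.rpow_neg_one]
      exact Real.rpow_le_rpow_of_exponent_le hR1 (by linarith)
    refine (norm_iterate_pd_mul_le j x (R ^ (-ρ)) m hσs (contDiff_dyadicCutoff hχ k) h3 h4).trans ?_
    have h9 : (2 : ℝ) ^ m ≤ 2 ^ N := pow_le_pow_right₀ one_le_two hm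
    calc 2 ^ m * (C * ω (R ^ (-ε)) * R ^ (-((n : ℝ) / 2) * (1 - ρ))) * B * (R ^ (-ρ)) ^ m
        ≤ 2 ^ N * (C * ω (R ^ (-ε)) * R ^ (-((n : ℝ) / 2) * (1 - ρ))) * B * (R ^ (-ρ)) ^ m := by
          gcongr
      _ = _ := by ring

lemma summable_omega_dyadic {ε : ℝ} (hε : 0 < ε) {ω : ℝ → ℝ} (hω_nonneg : ∀ t, 0 ≤ t → 0 ≤ ω t)
    (hω_mono : MonotoneOn ω (Set.Ici (0 : ℝ)))
    (hω_int : IntegrableOn (fun t => ω t * t⁻¹) (Set.Ioc (0 : ℝ) 1) volume) :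
    Summable fun k : ℕ => ω (((2 : ℝ) ^ k) ^ (-ε)) := by
  set x : ℕ → ℝ := fun k => ((2 : ℝ) ^ k) ^ (-ε) with hx
  set q : ℝ := (2 : ℝ) ^ (-ε) with hq
  have hq0 : 0 < q := by positivity
  have hq1 : q < 1 := Real.rpow_lt_one_of_one_lt_of_neg one_lt_two (by linarith)
  have hxs : ∀ k, x (k + 1) = q * x k := fun k => by
    simp only [hx, hq]
    rw [pow_succ', Real.mul_rpow (by norm_num) (by positivity)]
  have hx0 : ∀ k, 0 < x k := fun k => by positivity
  have hx1 : ∀ k, x k ≤ 1 := fun k =>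
    Real.rpow_le_one_of_one_le_of_nonpos (one_le_pow₀ one_le_two) (by linarith)
  have hle : ∀ k, x (k + 1) ≤ x k := fun k => by
    rw [hxs]
    nlinarith [hx0 k]
  have hsub : ∀ k, Set.Ioc (x (k + 1)) (x k) ⊆ Set.Ioc 0 1 := fun k =>
    Set.Ioc_subset_Ioc (hx0 _).le (hx1 k)
  have hstep : ∀ k, (1 - q) * ω (x (k + 1)) ≤ ∫ t in (x (k + 1))..(x k), ω t * t⁻¹ := by
    intro k
    rw [intervalIntegral.integral_of_le (hle k)]
    calc (1 - q) * ω (x (k + 1)) = ∫ t in Set.Ioc (x (k + 1)) (x k), ω (x (k + 1)) * (x k)⁻¹ := by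
          rw [setIntegral_const, measureReal_def, Real.volume_Ioc,
            ENNReal.toReal_ofReal (by linarith [hle k]), smul_eq_mul, hxs]
          have := (hx0 k).ne'
          field_simp
      _ ≤ _ := by
          refine setIntegral_mono_on (integrable_const _) (hω_int.mono_set (hsub k))
            measurableSet_Ioc fun t ht => ?_
          have ht0 : 0 < t := (hx0 _).trans ht.1
          have h1 : ω (x (k + 1)) ≤ ω t := hω_mono (hx0 _).le ht0.le ht.1.le
          have h2 : (x k)⁻¹ ≤ t⁻¹ := inv_anti₀ ht0 ht.2
          have := hω_nonneg t ht0.le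
          have := hx0 k
          gcongr
  have hII : ∀ k, IntervalIntegrable (fun t => ω t * t⁻¹) volume (x k) (x (k + 1)) := fun k =>
    ((intervalIntegrable_iff_integrableOn_Ioc_of_le (hle k)).mpr
      (hω_int.mono_set (hsub k))).symm
  rw [← summable_nat_add_iff 1]
  refine summable_of_sum_range_le (c := (1 - q)⁻¹ * ∫ t in Set.Ioc (0 : ℝ) 1, ω t * t⁻¹)
    (fun k => hω_nonneg _ (hx0 _).le) fun K => ?_
  rw [← div_eq_inv_mul, le_div_iff₀ (by linarith), mul_comm, Finset.mul_sum]
  refine (Finset.sum_le_sum fun k _ => hstep k).trans ?_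
  have h3 : ∑ k ∈ Finset.range K, ∫ t in (x (k + 1))..(x k), ω t * t⁻¹
      = ∫ t in (x K)..(x 0), ω t * t⁻¹ := by
    rw [intervalIntegral.integral_symm, ← intervalIntegral.sum_integral_adjacent_intervals
      fun k _ => hII k, ← Finset.sum_neg_distrib]
    exact Finset.sum_congr rfl fun k _ => intervalIntegral.integral_symm _ _
  have h4 : x K ≤ x 0 := antitone_nat_of_succ_le hle (Nat.zero_le K)
  rw [h3, intervalIntegral.integral_of_le h4]
  refine setIntegral_mono_set hω_int ?_ (Set.Ioc_subset_Ioc (hx0 K).le (hx1 0)).eventuallyLE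
  filter_upwards [ae_restrict_mem measurableSet_Ioc] with t ht
  exact mul_nonneg (hω_nonneg t ht.1.le) (inv_nonneg.mpr ht.1.le)

lemma finite_support_comp_castZ {n : ℕ} {f : (Fin n → ℝ) → ℂ} {L : ℝ}
    (hf : ∀ x, L < ‖x‖ → f x = 0) : (fun ξ => f (castZ ξ)).support.Finite := by
  refine (latticeBox n ⌈L⌉₊).finite_toSet.subset fun ξ hξ => ?_
  rw [Finset.mem_coe, mem_latticeBox]
  intro i
  by_contra! hi
  refine hξ (hf _ ?_)
  refine lt_of_lt_of_le ?_ (norm_le_pi_norm (castZ ξ) i)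
  rw [castZ, Real.norm_eq_abs]
  refine (Nat.le_ceil L).trans_lt ?_
  exact_mod_cast hi

lemma finite_support_comp_cutoff {n : ℕ} {χ : (Fin n → ℝ) → ℂ} (h2 : ∀ x, 2 ≤ ‖x‖ → χ x = 0)
    (σ : (Fin n → ℝ) → ℂ) (K : ℕ) :
    (fun ξ => σ (castZ ξ) * χ (((2 : ℝ) ^ K)⁻¹ • castZ ξ)).support.Finite :=
  finite_support_comp_castZ (f := fun x => σ x * χ (((2 : ℝ) ^ K)⁻¹ • x)) (L := 2 * 2 ^ K)
    fun x hx => by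
      rw [h2, mul_zero]
      rw [norm_smul, Real.norm_of_nonneg (by positivity), ← div_eq_inv_mul,
        le_div_iff₀ (by positivity)]
      exact hx.le

lemma trigSeries_add {n : ℕ} {c d : (Fin n → ℤ) → ℂ} (hc : c.support.Finite)
    (hd : d.support.Finite) (t : UnitAddTorus (Fin n)) :
    trigSeries (c + d) t = trigSeries c t + trigSeries d t := by
  rw [trigSeries, trigSeries, trigSeries,
    ← (summable_trigSeries hc t).tsum_add (summable_trigSeries hd t)]
  simp only [Pi.add_apply, add_mul]

lemma exists_integral_norm_trigSeries_cutoff_le {n N : ℕ} (hn : 1 ≤ n) (hN : n < 2 * N)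
    {ε ρ C : ℝ} (hε : 0 < ε) (hρ0 : 0 ≤ ρ)
    (hρ1 : ρ ≤ 1) (hC : 0 < C) {ω : ℝ → ℝ} (hω_nonneg : ∀ t, 0 ≤ t → 0 ≤ ω t)
    (hω_mono : MonotoneOn ω (Set.Ici (0 : ℝ)))
    (hω_int : IntegrableOn (fun t => ω t * t⁻¹) (Set.Ioc (0 : ℝ) 1) volume)
    {σ χ : (Fin n → ℝ) → ℂ} (hσs : ContDiff ℝ (⊤ : ℕ∞) σ)
    (hσ : ∀ j, ∀ m ≤ N, ∀ ξ, ‖(pd j)^[m] σ ξ‖ ≤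
      C * ω (jbR ξ ^ (-ε)) * jbR ξ ^ (-((n : ℝ) / 2) * (1 - ρ) - ρ * m))
    (hχ : ContDiff ℝ (⊤ : ℕ∞) χ) (h1 : ∀ x, ‖x‖ ≤ 1 → χ x = 1) (h2 : ∀ x, 2 ≤ ‖x‖ → χ x = 0) :
    ∃ A : ℝ, 0 < A ∧ ∀ K : ℕ,
      ∫ t, ‖trigSeries (fun ξ => σ (castZ ξ) * χ (((2 : ℝ) ^ K)⁻¹ • castZ ξ)) t‖ ≤ A := by
  obtain ⟨A, hA0, hA⟩ := exists_integral_norm_trigSeries_le hn hN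
  obtain ⟨B, hB0, hB⟩ :=
    exists_norm_iterate_pd_dyadic_le hε.le hρ0 hρ1 hC hω_nonneg hω_mono hσs hσ hχ h1 h2
  set a : ℕ → ℝ := fun k => B * (ω (((2 : ℝ) ^ k) ^ (-ε)) + (1 / 2) ^ k) with ha
  have hω0 : ∀ k : ℕ, 0 ≤ ω (((2 : ℝ) ^ k) ^ (-ε)) := fun k => hω_nonneg _ (by positivity)
  have ha0 : ∀ k, 0 < a k := fun k => by
    have := hω0 k
    positivity
  have hasum : Summable a :=
    ((summable_omega_dyadic hε hω_nonneg hω_mono hω_int).add summable_geometric_two).mul_left B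
  set c : ℕ → (Fin n → ℤ) → ℂ :=
    fun K ξ => σ (castZ ξ) * χ (((2 : ℝ) ^ K)⁻¹ • castZ ξ) with hc
  set d : ℕ → (Fin n → ℤ) → ℂ := fun k ξ => (σ * dyadicCutoff χ k) (castZ ξ) with hd
  have hcd : ∀ k, c (k + 1) = c k + d k := fun k => by
    funext ξ
    simp only [hc, hd, dyadicCutoff, Pi.add_apply, Pi.mul_apply]
    ring
  have hdfin : ∀ k, (d k).support.Finite := fun k =>
    finite_support_comp_castZ (L := 4 * 2 ^ k) fun x hx => by
      rw [Pi.mul_apply, dyadicCutoff_eq_zero h1 h2 (Or.inr hx), mul_zero]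
  have hcfin : ∀ k, (c k).support.Finite := finite_support_comp_cutoff h2 σ
  have hdle : ∀ k, ∫ t, ‖trigSeries (d k) t‖ ≤ A * a k := by
    intro k
    have hR : (0 : ℝ) < 2 ^ k := by positivity
    refine hA k (σ * dyadicCutoff χ k) (((2 : ℝ) ^ k) ^ (-ρ))
      (((2 : ℝ) ^ k) ^ (-((n : ℝ) / 2) * (1 - ρ))) (a k)
      (hσs.mul (contDiff_dyadicCutoff hχ k)) (by positivity) (ha0 k) ?_ ?_ ?_ ?_
    · rw [← Real.rpow_natCast _ n, ← Real.rpow_natCast _ n, ← Real.rpow_natCast _ 2,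
        ← Real.rpow_mul hR.le, ← Real.rpow_mul hR.le, ← Real.rpow_add hR, ← Real.rpow_add hR]
      convert Real.rpow_zero _ using 2
      push_cast
      ring
    · intro x hx
      rw [Pi.mul_apply, dyadicCutoff_eq_zero h1 h2 (Or.inr hx), mul_zero]
    · intro x
      refine (hB k 0 (Nat.zero_le _) ⟨0, hn⟩ x).trans ?_
      rw [pow_zero, mul_one]
      gcongr
      exact mul_le_mul_of_nonneg_left (le_add_of_nonneg_right (by positivity)) hB0.le
    · intro j x
      refine (hB k N le_rfl j x).trans ?_
      gcongr
      exact mul_le_mul_of_nonneg_left (le_add_of_nonneg_right (by positivity)) hB0.le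
  have hstep : ∀ K, ∫ t, ‖trigSeries (c K) t‖ ≤
      (∫ t, ‖trigSeries (c 0) t‖) + A * ∑ k ∈ Finset.range K, a k := by
    intro K
    induction K with
    | zero => simp
    | succ K ih =>
      have hi1 := integrable_of_continuous_torus (continuous_trigSeries (hcfin K)).norm
      have hi2 := integrable_of_continuous_torus (continuous_trigSeries (hdfin K)).norm
      calc ∫ t, ‖trigSeries (c (K + 1)) t‖
          ≤ ∫ t, (‖trigSeries (c K) t‖ + ‖trigSeries (d K) t‖) := by
            refine integral_mono
              (integrable_of_continuous_torus (continuous_trigSeries (hcfin _)).norm)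
              (hi1.add hi2) fun t => ?_
            simp only [hcd, trigSeries_add (hcfin K) (hdfin K)]
            exact norm_add_le _ _
        _ = (∫ t, ‖trigSeries (c K) t‖) + ∫ t, ‖trigSeries (d K) t‖ := integral_add hi1 hi2
        _ ≤ _ := by
            rw [Finset.sum_range_succ]
            linarith [hdle K]
  have hI0 : 0 ≤ ∫ t, ‖trigSeries (c 0) t‖ := integral_nonneg fun t => norm_nonneg _
  refine ⟨(∫ t, ‖trigSeries (c 0) t‖) + A * ∑' k, a k, ?_, fun K => (hstep K).trans ?_⟩
  · have := hasum.tsum_pos (fun k => (ha0 k).le) 0 (ha0 0)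
    positivity
  · gcongr
    exact hasum.sum_le_tsum _ fun k _ => (ha0 k).le

lemma lintegral_mul_rpow_le {α : Type*} [MeasurableSpace α] {μ : Measure α} {k F : α → ℝ≥0∞}
    (hk : Measurable k) (hF : Measurable F) {A : ℝ≥0∞} (hA : ∫⁻ y, k y ∂μ ≤ A) {r : ℝ}
    (hr : 1 ≤ r) :
    (∫⁻ y, k y * F y ∂μ) ^ r ≤ A ^ (r - 1) * ∫⁻ y, k y * F y ^ r ∂μ := by
  have hr0 : 0 < r := one_pos.trans_le hr
  have h := eLpNorm'_le_eLpNorm'_mul_rpow_measure_univ (μ := μ.withDensity k) one_pos hr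
    hF.aestronglyMeasurable
  simp only [eLpNorm'_eq_lintegral_enorm, enorm_eq_self, ENNReal.rpow_one, div_one,
    withDensity_apply _ MeasurableSet.univ, Measure.restrict_univ] at h
  rw [lintegral_withDensity_eq_lintegral_mul _ hk hF,
    lintegral_withDensity_eq_lintegral_mul _ hk (hF.pow_const r)] at h
  refine (ENNReal.rpow_le_rpow h hr0.le).trans ?_
  rw [ENNReal.mul_rpow_of_nonneg _ _ hr0.le, ← ENNReal.rpow_mul, ← ENNReal.rpow_mul,
    one_div_mul_cancel hr0.ne', ENNReal.rpow_one, mul_comm]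
  have : (1 - 1 / r) * r = r - 1 := by field_simp
  rw [this]
  simp only [Pi.mul_apply]
  gcongr

lemma eLpNorm_le_of_kernel_bound {α : Type*} [MeasurableSpace α] {μ : Measure α} [SFinite μ]
    {k : α → α → ℝ≥0∞} (hk : Measurable (Function.uncurry k)) {A : ℝ≥0∞}
    (h1 : ∀ x, ∫⁻ y, k x y ∂μ ≤ A) (h2 : ∀ y, ∫⁻ x, k x y ∂μ ≤ A) {f g : α → ℂ}
    (hf : Measurable f) (hg : ∀ x, ‖g x‖ₑ ≤ ∫⁻ y, k x y * ‖f y‖ₑ ∂μ) {p : ℝ≥0∞} (hp : 1 ≤ p) :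
    eLpNorm g p μ ≤ A * eLpNorm f p μ := by
  rcases eq_or_ne p ∞ with rfl | hp'
  · rw [eLpNorm_exponent_top, eLpNorm_exponent_top]
    refine eLpNormEssSup_le_of_ae_enorm_bound (.of_forall fun x => (hg x).trans ?_)
    calc ∫⁻ y, k x y * ‖f y‖ₑ ∂μ ≤ ∫⁻ y, k x y * eLpNormEssSup f μ ∂μ := by
          refine lintegral_mono_ae ?_
          filter_upwards [enorm_ae_le_eLpNormEssSup f μ] with y hy
          gcongr
      _ = (∫⁻ y, k x y ∂μ) * eLpNormEssSup f μ :=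
          lintegral_mul_const _ (hk.comp measurable_prodMk_left)
      _ ≤ _ := by
          gcongr
          exact h1 x
  · have hp0 : p ≠ 0 := (zero_lt_one.trans_le hp).ne'
    set r := p.toReal with hr
    have hr1 : 1 ≤ r := by
      rw [hr, ← ENNReal.toReal_one]
      exact ENNReal.toReal_mono hp' hp
    have hr0 : 0 < r := one_pos.trans_le hr1
    rw [eLpNorm_eq_lintegral_rpow_enorm_toReal hp0 hp',
      eLpNorm_eq_lintegral_rpow_enorm_toReal hp0 hp', ← hr, one_div]
    have hm : Measurable fun y => ‖f y‖ₑ ^ r := hf.enorm.pow_const r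
    have key : ∫⁻ x, ‖g x‖ₑ ^ r ∂μ ≤ A ^ r * ∫⁻ y, ‖f y‖ₑ ^ r ∂μ := by
      calc ∫⁻ x, ‖g x‖ₑ ^ r ∂μ
          ≤ ∫⁻ x, A ^ (r - 1) * ∫⁻ y, k x y * ‖f y‖ₑ ^ r ∂μ ∂μ := by
            refine lintegral_mono fun x => (ENNReal.rpow_le_rpow (hg x) hr0.le).trans ?_
            exact lintegral_mul_rpow_le (hk.comp measurable_prodMk_left) hf.enorm (h1 x) hr1
        _ = A ^ (r - 1) * ∫⁻ y, ∫⁻ x, k x y * ‖f y‖ₑ ^ r ∂μ ∂μ := by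
            have hm' : Measurable (Function.uncurry fun x y => k x y * ‖f y‖ₑ ^ r) :=
              hk.mul (hm.comp measurable_snd)
            rw [lintegral_const_mul _ hm'.lintegral_prod_right, lintegral_lintegral_swap
              hm'.aemeasurable]
        _ ≤ A ^ (r - 1) * ∫⁻ y, A * ‖f y‖ₑ ^ r ∂μ := by
            gcongr with y
            refine (lintegral_mul_const _ (hk.comp measurable_prodMk_right)).trans_le ?_
            gcongr
            exact h2 y
        _ = A ^ r * ∫⁻ y, ‖f y‖ₑ ^ r ∂μ := by
            rw [lintegral_const_mul _ hm, ← mul_assoc]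
            congr 1
            nth_rewrite 2 [← ENNReal.rpow_one A]
            rw [← ENNReal.rpow_add_of_nonneg _ _ (by linarith) one_pos.le, sub_add_cancel]
    calc (∫⁻ x, ‖g x‖ₑ ^ r ∂μ) ^ r⁻¹ ≤ (A ^ r * ∫⁻ y, ‖f y‖ₑ ^ r ∂μ) ^ r⁻¹ :=
          ENNReal.rpow_le_rpow key (by positivity)
      _ = _ := by
          rw [ENNReal.mul_rpow_of_nonneg _ _ (by positivity), ENNReal.rpow_rpow_inv hr0.ne']

lemma measurePreserving_toTorus_μT (n : ℕ) :
    MeasurePreserving (toTorus (n := n)) (μT n) volume := by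
  have h : μT n = volume.restrict (Set.univ.pi fun _ => Set.Ioc (0 : ℝ) (0 + 1)) := by
    rw [μT, cube, volume_pi, Measure.restrict_pi_pi, Measure.restrict_pi_pi]
    simp only [zero_add, Measure.restrict_congr_set Ico_ae_eq_Ioc]
  rw [h]
  exact measurePreserving_toTorus n 0

instance (n : ℕ) : IsFiniteMeasure (μT n) := by
  have := (measurePreserving_toTorus_μT n).measure_preimage MeasurableSet.univ.nullMeasurableSet
  rw [Set.preimage_univ] at this
  exact ⟨this ▸ measure_lt_top _ _⟩

lemma toTorus_sub {n : ℕ} (x y : Fin n → ℝ) : toTorus (x - y) = toTorus x - toTorus y := rfl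

lemma mFourier_toTorus {n : ℕ} (x : Fin n → ℝ) (ξ : Fin n → ℤ) :
    UnitAddTorus.mFourier ξ (toTorus x) = eChar x ξ := by
  rw [eChar, Finset.mul_sum, Complex.exp_sum]
  rw [UnitAddTorus.mFourier, ContinuousMap.coe_mk]
  refine Finset.prod_congr rfl fun j _ => ?_
  rw [toTorus, fourier_coe_apply]
  congr 1
  push_cast
  ring

lemma eChar_sub {n : ℕ} (x y : Fin n → ℝ) (ξ : Fin n → ℤ) :
    eChar (x - y) ξ = eChar x ξ *
      Complex.exp (-(2 * (π : ℂ) * Complex.I) * ∑ j, (y j : ℂ) * (ξ j : ℂ)) := by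
  rw [eChar, eChar, ← Complex.exp_add]
  congr 1
  simp only [Pi.sub_apply, Complex.ofReal_sub, sub_mul, Finset.sum_sub_distrib]
  ring

lemma continuous_eChar {n : ℕ} (ξ : Fin n → ℤ) : Continuous fun x => eChar x ξ := by
  unfold eChar
  fun_prop

lemma norm_eChar {n : ℕ} (x : Fin n → ℝ) (ξ : Fin n → ℤ) : ‖eChar x ξ‖ = 1 := by
  rw [← mFourier_toTorus, norm_mFourier_apply]

lemma integrable_μT {n : ℕ} {f : (Fin n → ℝ) → ℂ} (hf : Continuous f) : Integrable f (μT n) := by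
  refine (hf.continuousOn.integrableOn_compact
    (isCompact_univ_pi fun _ => isCompact_Icc (a := (0 : ℝ)) (b := 1))).mono_set ?_
  exact Set.pi_mono fun _ _ => Set.Ico_subset_Icc_self

lemma Op_eq_integral {n : ℕ} {c : (Fin n → ℤ) → ℂ} (hc : c.support.Finite)
    {f : (Fin n → ℝ) → ℂ} (hf : Continuous f) (x : Fin n → ℝ) :
    Op (fun _ => c) f x = ∫ y, trigSeries c (toTorus x - toTorus y) * f y ∂(μT n) := by
  have hS : ∀ ξ ∉ hc.toFinset, c ξ = 0 := by simp
  simp only [trigSeries_eq_sum hS, Finset.sum_mul]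
  rw [integral_finsetSum _ fun ξ _ => integrable_μT ?_, Op,
    tsum_eq_sum fun ξ hξ => by rw [hS ξ hξ, mul_zero, zero_mul]]
  · refine Finset.sum_congr rfl fun ξ _ => ?_
    rw [fc, ← integral_const_mul]
    congr 1
    funext y
    rw [← toTorus_sub, mFourier_toTorus, eChar_sub]
    ring
  · have := continuous_toTorus (n := n)
    fun_prop

lemma continuous_Op {n : ℕ} {c : (Fin n → ℤ) → ℂ} (hc : c.support.Finite)
    (f : (Fin n → ℝ) → ℂ) : Continuous (Op (fun _ => c) f) := by
  have h : Op (fun _ => c) f = fun x => ∑ ξ ∈ hc.toFinset, eChar x ξ * c ξ * fc f ξ := by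
    funext x
    exact tsum_eq_sum fun ξ hξ => by
      simp [show c ξ = 0 by simpa using hξ]
  rw [h]
  have := continuous_eChar (n := n)
  fun_prop

lemma eLpNorm_Op_le {n : ℕ} {c : (Fin n → ℤ) → ℂ} (hc : c.support.Finite)
    {f : (Fin n → ℝ) → ℂ} (hf : Continuous f) {p : ℝ≥0∞} (hp : 1 ≤ p) :
    eLpNorm (Op (fun _ => c) f) p (μT n) ≤
      ENNReal.ofReal (∫ t, ‖trigSeries c t‖) * eLpNorm f p (μT n) := by
  have hκ := continuous_trigSeries hc
  have hT := continuous_toTorus (n := n)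
  have : (volume : Measure (UnitAddTorus (Fin n))).IsNegInvariant :=
    Measure.IsAddHaarMeasure.isNegInvariant_of_regular _
  rw [ofReal_integral_norm_eq_lintegral_enorm (integrable_of_continuous_torus hκ)]
  refine eLpNorm_le_of_kernel_bound
    (k := fun x y => ‖trigSeries c (toTorus x - toTorus y)‖ₑ) ?_ (fun x => ?_) (fun y => ?_)
    hf.measurable (fun x => ?_) hp
  · exact (Continuous.enorm (by fun_prop)).measurable
  · rw [(measurePreserving_toTorus_μT n).lintegral_comp
      (f := fun t => ‖trigSeries c (toTorus x - t)‖ₑ)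
      (Continuous.enorm (by fun_prop)).measurable,
      lintegral_sub_left_eq_self (fun t => ‖trigSeries c t‖ₑ)]
  · rw [(measurePreserving_toTorus_μT n).lintegral_comp
      (f := fun t => ‖trigSeries c (t - toTorus y)‖ₑ)
      (Continuous.enorm (by fun_prop)).measurable,
      lintegral_sub_right_eq_self (fun t => ‖trigSeries c t‖ₑ)]
  · rw [Op_eq_integral hc hf]
    refine (enorm_integral_le_lintegral_enorm _).trans_eq ?_
    simp only [enorm_mul]

lemma eLpNorm_Op_le_of_tendsto {n : ℕ} {s : (Fin n → ℤ) → ℂ} {c : ℕ → (Fin n → ℤ) → ℂ} {M A : ℝ}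
    (hc : ∀ K, (c K).support.Finite) (hM : ∀ K ξ, ‖c K ξ‖ ≤ M * ‖s ξ‖)
    (hlim : ∀ ξ, Filter.Tendsto (fun K => c K ξ) Filter.atTop (nhds (s ξ)))
    (hA : ∀ K, ∫ t, ‖trigSeries (c K) t‖ ≤ A)
    {f : (Fin n → ℝ) → ℂ} (hf : Continuous f) {p : ℝ≥0∞} (hp : 1 ≤ p) :
    eLpNorm (Op (fun _ => s) f) p (μT n) ≤ ENNReal.ofReal A * eLpNorm f p (μT n) := by
  have hnorm : ∀ (x : Fin n → ℝ) ξ, ‖eChar x ξ * s ξ * fc f ξ‖ = ‖s ξ * fc f ξ‖ := fun x ξ => by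
    rw [mul_assoc, norm_mul, norm_eChar, one_mul]
  by_cases hs : Summable fun ξ => ‖s ξ * fc f ξ‖
  · refine (Lp.eLpNorm_lim_le_liminf_eLpNorm (f := fun K => Op (fun _ => c K) f)
      (fun K => (continuous_Op (hc K) f).aestronglyMeasurable) _
      (.of_forall fun x => ?_)).trans ?_
    · refine tendsto_tsum_of_dominated_convergence (hs.mul_left M) (fun ξ => ?_)
        (.of_forall fun K ξ => ?_)
      · exact ((hlim ξ).const_mul _).mul_const _
      · rw [mul_assoc, norm_mul, norm_eChar, one_mul, norm_mul, norm_mul, ← mul_assoc]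
        gcongr
        exact hM K ξ
    · refine Filter.liminf_le_of_le (by isBoundedDefault) fun b hb => ?_
      obtain ⟨K, hK⟩ := hb.exists
      refine hK.trans ((eLpNorm_Op_le (hc K) hf hp).trans ?_)
      gcongr
      exact hA K
  · have h0 : Op (fun _ => s) f = 0 := by
      funext x
      refine tsum_eq_zero_of_not_summable fun h => hs ?_
      simpa only [hnorm] using h.norm
    rw [h0, eLpNorm_zero]
    exact zero_le

/-- If a smooth symbol `σ₁ : ℝⁿ → ℂ` satisfies
`|∂_ξ^α σ₁(ξ)| ≤ C ω(⟨ξ⟩^{-ε}) ⟨ξ⟩^{-(n/2)(1-ρ) - ρ|α|}` for `|α| ≤ [n/2]+1`, then the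
periodic Fourier multiplier with symbol `σ₁|_{ℤⁿ}` is bounded on `L^p(𝕋ⁿ)`, `1 ≤ p ≤ ∞`. -/
theorem periodic_multiplier_omega_Lp_bounded
    (n : ℕ) (hn : 1 ≤ n) (ε ρ : ℝ) (p : ℝ≥0∞)
    (hε0 : 0 < ε) (hε1 : ε ≤ 1) (hρ0 : 0 ≤ ρ) (hρ1 : ρ ≤ 1) (hp : 1 ≤ p)
    (ω : ℝ → ℝ) (hω_nonneg : ∀ t, 0 ≤ t → 0 ≤ ω t)
    (hω_mono : MonotoneOn ω (Set.Ici (0 : ℝ)))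
    (hω_bdd : ∃ M : ℝ, ∀ t, 0 ≤ t → ω t ≤ M)
    (hω_int : IntegrableOn (fun t => ω t * t⁻¹) (Set.Ioc (0 : ℝ) 1) volume)
    (σ₁ : (Fin n → ℝ) → ℂ)
    (hσ_smooth : ContDiff ℝ (⊤ : ℕ∞) σ₁)
    (C : ℝ) (hC : 0 < C)
    (hσ : ∀ α : Fin n → ℕ, (∑ j, α j) ≤ n / 2 + 1 →
      ∀ ξ : Fin n → ℝ,
        ‖pdM α σ₁ ξ‖ ≤
          C * ω (jbR ξ ^ (-ε)) * jbR ξ ^ (-((n : ℝ) / 2) * (1 - ρ) - ρ * ∑ j, (α j : ℝ))) :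
    ∃ C' : ℝ, 0 < C' ∧ ∀ f : (Fin n → ℝ) → ℂ, ContDiff ℝ (⊤ : ℕ∞) f → Per f →
      eLpNorm (Op (fun _ ξ => σ₁ (castZ ξ)) f) p (μT n) ≤
        ENNReal.ofReal C' * eLpNorm f p (μT n) := by
  obtain ⟨χ, hχ, h1, h2⟩ := exists_cutoff n
  have hN : n < 2 * (n / 2 + 1) := by omega
  have hσ' : ∀ j, ∀ m ≤ n / 2 + 1, ∀ ξ, ‖(pd j)^[m] σ₁ ξ‖ ≤
      C * ω (jbR ξ ^ (-ε)) * jbR ξ ^ (-((n : ℝ) / 2) * (1 - ρ) - ρ * m) := by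
    intro j m hm ξ
    have h := hσ (Pi.single j m) (by simpa using hm) ξ
    rw [pdM_single] at h
    have hsum : ∑ i, ((Pi.single j m : Fin n → ℕ) i : ℝ) = m := by
      rw [← Nat.cast_sum, Finset.sum_pi_single', if_pos (Finset.mem_univ j)]
    rwa [hsum] at h
  obtain ⟨A, hA0, hA⟩ := exists_integral_norm_trigSeries_cutoff_le hn hN hε0 hρ0 hρ1 hC
    hω_nonneg hω_mono hω_int hσ_smooth hσ' hχ h1 h2
  obtain ⟨M, hM⟩ := hχ.continuous.bounded_above_of_compact_support
    (HasCompactSupport.intro (isCompact_closedBall 0 2) fun x hx => h2 x (by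
      rw [mem_closedBall_zero_iff, not_le] at hx
      exact hx.le))
  refine ⟨A, hA0, fun f hf _ => eLpNorm_Op_le_of_tendsto (M := M) (fun K => ?_) (fun K ξ => ?_)
    (fun ξ => ?_) hA hf.continuous hp⟩
  · exact finite_support_comp_cutoff h2 σ₁ K
  · rw [norm_mul, mul_comm]
    gcongr
    exact hM _
  · refine tendsto_const_nhds.congr' ?_
    obtain ⟨K₀, hK₀⟩ := pow_unbounded_of_one_lt ‖castZ ξ‖ one_lt_two
    filter_upwards [Filter.eventually_ge_atTop K₀] with K hK
    rw [h1, mul_one]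
    rw [norm_smul, Real.norm_of_nonneg (by positivity), ← div_eq_inv_mul,
      div_le_one (by positivity)]
    exact hK₀.le.trans (pow_le_pow_right₀ one_le_two hK)
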